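/- If X• is a simplicial manifold and (U_j)_{j∈J} is an open covering of X_m, then there exists a simplicial covering U of X•, i.e. a simplicial set I• together with open coverings (U^{(n)}_i)_{i∈I^{(n)}} of each X_n such that X•(α)(U^{(m')}_i) ⊆ U^{(n)}_{I•(α)(i)} for every α:[n]→[m'], with the property that (U^{(m)}_i)_{i∈I^{(m)}} refines (U_j)_{j∈J}. -/

import Mathlib

open CategoryTheory

/-- The simplicial set `n ↦ J^{Δ(m,n)}`, acted on by precomposition. -/
def homIndexing (m : SimplexCategory) (J : Type) : SimplicialObject Type where
  obj n := (m ⟶ n.unop) → J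
  map α := ↾fun i f => i (f ≫ α.unop)

/-- If `X•` is a simplicial manifold (formalized, as allowed, as a
simplicial topological space `X : SimplicialObject TopCat`) and `(U_j)_{j∈J}` is
an open covering of `X_m`, then there exists a covering `𝒰` of `X•`: a
simplicial set `I•` together with open coverings `(V^{(n)}_i)_{i∈I^{(n)}}` of
each `X_n` such that `X•(α)(V^{(n)}_i) ⊆ V^{(n')}_{I•(α)(i)}` for every `α`, and
such that `(V^{(m)}_i)_{i∈I^{(m)}}` refines `(U_j)_{j∈J}`. -/
theorem stmt0 (X : SimplicialObject TopCat) (m : SimplexCategory) (J : Type)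
    (U : J → Set (X.obj (Opposite.op m)))
    (hUopen : ∀ j, IsOpen (U j))
    (hUcov : ∀ x : X.obj (Opposite.op m), ∃ j, x ∈ U j) :
    ∃ (I : SimplicialObject (Type))
      (V : ∀ n : SimplexCategoryᵒᵖ, I.obj n → Set (X.obj n)),
      (∀ (n : SimplexCategoryᵒᵖ) (i : I.obj n), IsOpen (V n i)) ∧
      (∀ (n : SimplexCategoryᵒᵖ) (x : X.obj n), ∃ i : I.obj n, x ∈ V n i) ∧
      (∀ (n n' : SimplexCategoryᵒᵖ) (α : n ⟶ n') (i : I.obj n),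
        (X.map α) '' (V n i) ⊆ V n' (I.map α i)) ∧
      (∀ i : I.obj (Opposite.op m), ∃ j : J, V (Opposite.op m) i ⊆ U j) := by
  refine ⟨homIndexing m J, fun n i => ⋂ f : m ⟶ n.unop, X.map f.op ⁻¹' U (i f),
    fun n i => ?_, fun n x => ?_, fun n n' α i => ?_, fun i => ⟨i (𝟙 m), fun x hx => ?_⟩⟩
  · exact isOpen_iInter_of_finite fun f => (hUopen (i f)).preimage (X.map f.op).hom.continuous
  · choose j hj using hUcov
    exact ⟨fun f => j (X.map f.op x), Set.mem_iInter.2 fun f => hj _⟩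
  · rintro _ ⟨x, hx, rfl⟩
    refine Set.mem_iInter.2 fun f => ?_
    have h : X.map (f ≫ α.unop).op x ∈ U (i (f ≫ α.unop)) := Set.mem_iInter.1 hx (f ≫ α.unop)
    rw [op_comp, Quiver.Hom.op_unop, X.map_comp] at h
    exact h
  · have h : X.map (𝟙 m).op x ∈ U (i (𝟙 m)) := Set.mem_iInter.1 hx (𝟙 m)
    rw [op_id, X.map_id] at h
    exact h
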